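/- arXiv:2601.02595 — 7 statements merged into one kernel-verified Lean document; each statement's English description precedes it below -/
import Mathlib

section
/- Fix M > 0. There exists a constant C > 0 such that for every ε with 0 < ε ≤ M and every continuous 2π-periodic function f : ℝ → ℂ (equivalently, a continuous function on the circle AddCircle (2π)) whose Fourier coefficients f̂(n) := (1/(2π)) ∫_0^{2π} f(x) e^{-inx} dx satisfy Σ_{n ∈ ℤ} (1 + n²)^{1/2 + ε} |f̂(n)|² < ∞, one has sup_{x ∈ ℝ} |f(x)| ≤ C ε^{-1/2} ( Σ_{n ∈ ℤ} (1 + n²)^{1/2 + ε} |f̂(n)|² )^{1/2}. -/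
open scoped Real

/-- The circle of circumference `2π` has positive parameter. -/
local instance : Fact ((0 : ℝ) < 2 * π) := ⟨by positivity⟩

/-- Telescoping bound comparing `(t + 1) ^ (-(1 + s))` with the increment of `t ^ (-s)`. -/
lemma mul_rpow_neg_one_add_le_sub {s t : ℝ} (hs : 0 < s) (ht : 0 < t) :
    s * (t + 1) ^ (-(1 + s)) ≤ t ^ (-s) - (t + 1) ^ (-s) := by
  have hb : 0 < t + 1 := by linarith
  have hq : 0 < t / (t + 1) := by positivity
  have hlog := Real.log_le_sub_one_of_pos hq
  have hsub : t / (t + 1) - 1 = -(1 / (t + 1)) := by field_simp; ring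
  have hbern : 1 + s * (1 / (t + 1)) ≤ (t / (t + 1)) ^ (-s) := by
    rw [Real.rpow_def_of_pos hq]
    have := Real.add_one_le_exp (Real.log (t / (t + 1)) * -s)
    nlinarith
  have hfac : t ^ (-s) = (t + 1) ^ (-s) * (t / (t + 1)) ^ (-s) := by
    rw [← Real.mul_rpow hb.le hq.le, mul_div_cancel₀ _ hb.ne']
  have hpow : (t + 1) ^ (-(1 + s)) = (t + 1) ^ (-s) * (1 / (t + 1)) := by
    rw [neg_add_rev, Real.rpow_add hb, Real.rpow_neg_one, one_div]
  have := mul_le_mul_of_nonneg_left hbern (Real.rpow_nonneg hb.le (-s))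
  rw [hfac, hpow]
  linarith

lemma sum_range_rpow_neg_one_add_le {s : ℝ} (hs : 0 < s) (N : ℕ) :
    ∑ k ∈ Finset.range N, ((k : ℝ) + 1) ^ (-(1 + s)) ≤ 1 + 1 / s := by
  have key : ∀ N : ℕ, ∑ k ∈ Finset.range (N + 1), ((k : ℝ) + 1) ^ (-(1 + s)) ≤
      1 + (1 - ((N : ℝ) + 1) ^ (-s)) / s := by
    intro N
    induction N with
    | zero => simp
    | succ N ih =>
      rw [Finset.sum_range_succ]
      have h := mul_rpow_neg_one_add_le_sub hs (t := (N : ℝ) + 1) (by positivity)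
      rw [mul_comm, ← le_div_iff₀ hs] at h
      push_cast
      calc _ ≤ _ := add_le_add ih h
        _ = _ := by ring
  cases N with
  | zero => simp; positivity
  | succ N =>
    refine (key N).trans ?_
    have : 0 ≤ ((N : ℝ) + 1) ^ (-s) := by positivity
    gcongr
    linarith

lemma summable_and_tsum_one_add_sq_rpow_le {ε : ℝ} (hε : 0 < ε) :
    Summable (fun n : ℤ => (1 + (n : ℝ) ^ 2) ^ (-(1 / 2 + ε))) ∧
      ∑' n : ℤ, (1 + (n : ℝ) ^ 2) ^ (-(1 / 2 + ε)) ≤ 3 + 1 / ε := by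
  have hterm : ∀ k : ℕ, (1 + ((k : ℝ) + 1) ^ 2) ^ (-(1 / 2 + ε)) ≤
      ((k : ℝ) + 1) ^ (-(1 + 2 * ε)) := by
    intro k
    have hk : (0 : ℝ) < (k : ℝ) + 1 := by positivity
    calc (1 + ((k : ℝ) + 1) ^ 2) ^ (-(1 / 2 + ε))
        ≤ (((k : ℝ) + 1) ^ 2) ^ (-(1 / 2 + ε)) :=
          Real.rpow_le_rpow_of_nonpos (by positivity) (by linarith) (by linarith)
      _ = ((k : ℝ) + 1) ^ (-(1 + 2 * ε)) := by
          rw [← Real.rpow_natCast, ← Real.rpow_mul hk.le]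
          congr 1
          push_cast
          ring
  have hnn : ∀ k : ℕ, (0 : ℝ) ≤ (1 + ((k : ℝ) + 1) ^ 2) ^ (-(1 / 2 + ε)) :=
    fun k => by positivity
  have hpartial : ∀ N : ℕ, ∑ k ∈ Finset.range N, (1 + ((k : ℝ) + 1) ^ 2) ^ (-(1 / 2 + ε)) ≤
      1 + 1 / (2 * ε) := fun N =>
    (Finset.sum_le_sum fun k _ => hterm k).trans
      (sum_range_rpow_neg_one_add_le (by linarith) N)
  have hsum := (summable_of_sum_range_le hnn hpartial).hasSum
  have hle := Real.tsum_le_of_sum_range_le hnn hpartial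
  have hZ := HasSum.of_add_one_of_neg_add_one
    (f := fun n : ℤ => (1 + (n : ℝ) ^ 2) ^ (-(1 / 2 + ε)))
    (by push_cast; exact hsum) (by push_cast; simp only [neg_sq]; exact hsum)
  refine ⟨hZ.summable, ?_⟩
  rw [hZ.tsum_eq]
  have h2 : 1 / (2 * ε) + 1 / (2 * ε) = 1 / ε := by field_simp; norm_num
  simp only [Int.cast_zero, ne_eq, OfNat.ofNat_ne_zero, not_false_eq_true, zero_pow, add_zero,
    Real.one_rpow]
  linarith

/-- Weighted Cauchy-Schwarz inequality for series. -/
lemma summable_and_tsum_le_of_weight {ι : Type*} {w a : ι → ℝ} (hw : ∀ i, 0 < w i)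
    (ha : ∀ i, 0 ≤ a i) (hw_sum : Summable fun i => (w i)⁻¹)
    (hwa : Summable fun i => w i * a i ^ 2) :
    Summable a ∧ ∑' i, a i ≤
      (∑' i, (w i)⁻¹) ^ ((1 : ℝ) / 2) * (∑' i, w i * a i ^ 2) ^ ((1 : ℝ) / 2) := by
  have h1 : ∀ i, (√(w i))⁻¹ ^ (2 : ℝ) = (w i)⁻¹ := fun i => by
    rw [Real.rpow_two, inv_pow, Real.sq_sqrt (hw i).le]
  have h2 : ∀ i, (√(w i) * a i) ^ (2 : ℝ) = w i * a i ^ 2 := fun i => by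
    rw [Real.rpow_two, mul_pow, Real.sq_sqrt (hw i).le]
  have h3 : ∀ i, (√(w i))⁻¹ * (√(w i) * a i) = a i := fun i =>
    inv_mul_cancel_left₀ (Real.sqrt_pos.2 (hw i)).ne' _
  have := Real.summable_and_inner_le_Lp_mul_Lq_tsum_of_nonneg
    (f := fun i => (√(w i))⁻¹) (g := fun i => √(w i) * a i) Real.HolderConjugate.two_two
    (fun i => by positivity) (fun i => mul_nonneg (Real.sqrt_nonneg _) (ha i))
    (by simpa only [h1] using hw_sum) (by simpa only [h2] using hwa)
  simpa only [h1, h2, h3] using this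

lemma norm_apply_le_tsum_norm_fourierCoeff {T : ℝ} [Fact (0 < T)] (f : C(AddCircle T, ℂ))
    (h : Summable fun n : ℤ => ‖fourierCoeff f n‖) (x : AddCircle T) :
    ‖f x‖ ≤ ∑' n : ℤ, ‖fourierCoeff f n‖ := by
  have hnorm : ∀ n : ℤ, ‖fourierCoeff f n • fourier n x‖ = ‖fourierCoeff f n‖ := fun n => by
    rw [norm_smul, fourier_apply, Circle.norm_coe, mul_one]
  rw [← (has_pointwise_sum_fourier_series_of_summable h.of_norm x).tsum_eq]
  refine (norm_tsum_le_tsum_norm (by simpa only [hnorm] using h)).trans_eq ?_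
  simp only [hnorm]

/-- Fix `M > 0`. There is a constant `C > 0` such that for every `0 < ε ≤ M` and every
continuous `2π`-periodic function `f` (a continuous function on `AddCircle (2π)`) whose
Fourier coefficients satisfy `Σ_{n ∈ ℤ} (1 + n²)^{1/2 + ε} |f̂(n)|² < ∞`, one has
`sup_x |f(x)| ≤ C ε^{-1/2} (Σ_{n ∈ ℤ} (1 + n²)^{1/2 + ε} |f̂(n)|²)^{1/2}`. -/
theorem stmt_3 (M : ℝ) (hM : 0 < M) :
    ∃ C > (0 : ℝ), ∀ ε : ℝ, 0 < ε → ε ≤ M →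
      ∀ f : C(AddCircle (2 * π), ℂ),
        Summable (fun n : ℤ =>
          (1 + (n : ℝ) ^ 2) ^ ((1 / 2 + ε) : ℝ) *
            ‖fourierCoeff (f : AddCircle (2 * π) → ℂ) n‖ ^ 2) →
        ∀ x : AddCircle (2 * π),
          ‖f x‖ ≤ C * ε ^ (-(1 / 2) : ℝ) *
            (∑' n : ℤ,
              (1 + (n : ℝ) ^ 2) ^ ((1 / 2 + ε) : ℝ) *
                ‖fourierCoeff (f : AddCircle (2 * π) → ℂ) n‖ ^ 2) ^ ((1 : ℝ) / 2) := by
  refine ⟨(3 * M + 1) ^ ((1 : ℝ) / 2), by positivity, fun ε hε hεM f hf x => ?_⟩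
  obtain ⟨hw, hw_le⟩ := summable_and_tsum_one_add_sq_rpow_le hε
  have hinv : ∀ n : ℤ, (1 + (n : ℝ) ^ 2) ^ (-(1 / 2 + ε)) =
      ((1 + (n : ℝ) ^ 2) ^ (1 / 2 + ε))⁻¹ := fun n => Real.rpow_neg (by positivity) _
  simp only [hinv] at hw hw_le
  obtain ⟨ha, ha_le⟩ := summable_and_tsum_le_of_weight
    (w := fun n : ℤ => (1 + (n : ℝ) ^ 2) ^ (1 / 2 + ε)) (fun n => by positivity)
    (fun n => norm_nonneg (fourierCoeff f n)) hw hf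
  refine (norm_apply_le_tsum_norm_fourierCoeff f ha x).trans (ha_le.trans ?_)
  refine mul_le_mul_of_nonneg_right ?_
    (Real.rpow_nonneg (tsum_nonneg fun n => by positivity) _)
  rw [Real.rpow_neg hε.le, ← div_eq_mul_inv, ← Real.div_rpow (by positivity) hε.le]
  refine Real.rpow_le_rpow (tsum_nonneg fun n => by positivity) (hw_le.trans ?_) (by norm_num)
  rw [le_div_iff₀ hε, add_mul, one_div_mul_cancel hε.ne']
  linarith
end

section
/- Let V and Q be real Hilbert spaces, let a : V × V → ℝ be a continuous symmetric bilinear form that is coercive with constant α > 0, let b : V × Q → ℝ be a continuous bilinear form, let c : Q × Q → ℝ be a continuous symmetric bilinear form that is coercive with constant γ > 0, let K ⊆ V be a nonempty closed convex set, and let F : V → ℝ be a continuous linear functional. Then there exists exactly one pair (u, p) ∈ K × Q that solves the mixed variational inequality system for the data (a, b, c, K, F). -/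
open scoped RealInnerProductSpace

/-- Maps satisfying the variational characterization of the projection onto a set are
nonexpansive. -/
theorem norm_sub_le_of_inner_le_zero {H : Type*} [NormedAddCommGroup H] [InnerProductSpace ℝ H]
    {x y x' y' : H} (hx : ⟪x - x', y' - x'⟫ ≤ 0) (hy : ⟪y - y', x' - y'⟫ ≤ 0) :
    ‖x' - y'‖ ≤ ‖x - y‖ := by
  have h : ‖x' - y'‖ ^ 2 ≤ ⟪x - y, x' - y'⟫ := by
    rw [← real_inner_self_eq_norm_sq]
    simp only [inner_sub_left, inner_sub_right] at *
    linarith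
  have h' := real_inner_le_norm (x - y) (x' - y')
  nlinarith [norm_nonneg (x' - y'), norm_nonneg (x - y)]

/-- A gradient step for a strongly monotone bounded operator is a strict contraction, provided the
step size is small enough. -/
theorem ContinuousLinearMap.exists_step_contracting {H : Type*} [NormedAddCommGroup H]
    [InnerProductSpace ℝ H] (T : H →L[ℝ] H) {δ : ℝ} (hδ : 0 < δ)
    (hT : ∀ x, δ * ‖x‖ ^ 2 ≤ ⟪T x, x⟫) :
    ∃ ρ : ℝ, 0 < ρ ∧ ∃ k : NNReal, k < 1 ∧ ∀ x, ‖x - ρ • T x‖ ≤ k * ‖x‖ := by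
  set M : ℝ := ‖T‖ + δ
  have hM : 0 < M := by positivity
  have hδM : δ ^ 2 / M ^ 2 ≤ 1 := by
    rw [div_le_one (by positivity)]
    exact pow_le_pow_left₀ hδ.le (le_add_of_nonneg_left (norm_nonneg T)) 2
  refine ⟨δ / M ^ 2, by positivity, .mk √(1 - δ ^ 2 / M ^ 2) (Real.sqrt_nonneg _), ?_,
    fun x ↦ ?_⟩
  · rw [← NNReal.coe_lt_coe, NNReal.coe_mk, NNReal.coe_one, Real.sqrt_lt' one_pos, one_pow,
      sub_lt_self_iff]
    positivity
  · refine (sq_le_sq₀ (norm_nonneg _) (by positivity)).1 ?_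
    have hTx : ‖T x‖ ^ 2 ≤ M ^ 2 * ‖x‖ ^ 2 := by
      rw [← mul_pow]
      refine pow_le_pow_left₀ (norm_nonneg _) ((T.le_opNorm x).trans ?_) 2
      gcongr
      exact le_add_of_nonneg_right hδ.le
    rw [mul_pow, NNReal.coe_mk, Real.sq_sqrt (by linarith), norm_sub_sq_real,
      inner_smul_right, norm_smul, mul_pow, Real.norm_eq_abs, sq_abs, real_inner_comm]
    have h₁ : δ / M ^ 2 * (δ * ‖x‖ ^ 2) ≤ δ / M ^ 2 * ⟪T x, x⟫ := by gcongr; exact hT x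
    have h₂ : (δ / M ^ 2) ^ 2 * ‖T x‖ ^ 2 ≤ (δ / M ^ 2) ^ 2 * (M ^ 2 * ‖x‖ ^ 2) := by gcongr
    have h₃ : (δ / M ^ 2) ^ 2 * (M ^ 2 * ‖x‖ ^ 2) = δ ^ 2 / M ^ 2 * ‖x‖ ^ 2 := by field_simp
    have h₄ : δ / M ^ 2 * (δ * ‖x‖ ^ 2) = δ ^ 2 / M ^ 2 * ‖x‖ ^ 2 := by ring
    linarith

/-- **Lions–Stampacchia theorem** (existence): a variational inequality for a bounded coercive, not
necessarily symmetric, bilinear form has a solution. -/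
theorem IsCoercive.exists_variational_inequality {H : Type*} [NormedAddCommGroup H]
    [InnerProductSpace ℝ H] [CompleteSpace H] {B : H →L[ℝ] H →L[ℝ] ℝ} (hB : IsCoercive B)
    {K : Set H} (hne : K.Nonempty) (hcl : IsClosed K) (hcx : Convex ℝ K) (F : H →L[ℝ] ℝ) :
    ∃ u ∈ K, ∀ v ∈ K, F (v - u) ≤ B u (v - u) := by
  obtain ⟨δ, hδ, hcoer⟩ := hB
  set T : H →L[ℝ] H := InnerProductSpace.continuousLinearMapOfBilin (𝕜 := ℝ) B
  have hT : ∀ x y, ⟪T x, y⟫ = B x y :=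
    InnerProductSpace.continuousLinearMapOfBilin_apply (𝕜 := ℝ) B
  set f : H := (InnerProductSpace.toDual ℝ H).symm F
  have hf : ∀ y, ⟪f, y⟫ = F y := fun y ↦ InnerProductSpace.toDual_symm_apply
  obtain ⟨ρ, hρ, k, hk, hstep⟩ := T.exists_step_contracting hδ fun x ↦ by
    rw [hT, pow_two, ← mul_assoc]
    exact hcoer x
  have hproj : ∀ x, ∃ w ∈ K, ∀ y ∈ K, ⟪x - w, y - w⟫ ≤ 0 := fun x ↦ by
    obtain ⟨w, hw, hmin⟩ := exists_norm_eq_iInf_of_complete_convex hne hcl.isComplete hcx x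
    exact ⟨w, hw, (norm_eq_iInf_iff_real_inner_le_zero hcx hw).1 hmin⟩
  choose P hPK hP using hproj
  have hcontr : ContractingWith k fun x ↦ P (x - ρ • (T x - f)) := by
    refine ⟨hk, LipschitzWith.of_dist_le_mul fun x y ↦ ?_⟩
    rw [dist_eq_norm, dist_eq_norm]
    refine (norm_sub_le_of_inner_le_zero (hP _ _ (hPK _)) (hP _ _ (hPK _))).trans ?_
    have hxy : x - ρ • (T x - f) - (y - ρ • (T y - f)) = x - y - ρ • T (x - y) := by
      rw [map_sub]
      module
    rw [hxy]
    exact hstep (x - y)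
  set u := ContractingWith.fixedPoint _ hcontr
  have hu : P (u - ρ • (T u - f)) = u := hcontr.fixedPoint_isFixedPt
  refine ⟨u, hu ▸ hPK _, fun v hv ↦ ?_⟩
  have h := hP (u - ρ • (T u - f)) v hv
  rw [hu, sub_sub_cancel_left, inner_neg_left, inner_smul_left, inner_sub_left, hT, hf] at h
  simp only [conj_trivial] at h
  nlinarith

/-- Existence for mixed variational inequalities, by applying the Lions–Stampacchia theorem on
the product space. -/
theorem exists_mixed_variational_inequality {V Q : Type*}
    [NormedAddCommGroup V] [InnerProductSpace ℝ V] [CompleteSpace V]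
    [NormedAddCommGroup Q] [InnerProductSpace ℝ Q] [CompleteSpace Q]
    {a : V →L[ℝ] V →L[ℝ] ℝ} (ha : IsCoercive a) (b : V →L[ℝ] Q →L[ℝ] ℝ)
    {c : Q →L[ℝ] Q →L[ℝ] ℝ} (hc : IsCoercive c)
    {K : Set V} (hne : K.Nonempty) (hcl : IsClosed K) (hcx : Convex ℝ K) (F : V →L[ℝ] ℝ) :
    ∃ u ∈ K, ∃ p : Q, (∀ v ∈ K, F (v - u) ≤ a u (v - u) + b (v - u) p) ∧
      ∀ q, b u q - c p q = 0 := by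
  obtain ⟨α, hα, ha⟩ := ha
  obtain ⟨γ, hγ, hc⟩ := hc
  let π₁ : WithLp 2 (V × Q) →L[ℝ] V := WithLp.fstL 2 ℝ V Q
  let π₂ : WithLp 2 (V × Q) →L[ℝ] Q := WithLp.sndL 2 ℝ V Q
  let B : WithLp 2 (V × Q) →L[ℝ] WithLp 2 (V × Q) →L[ℝ] ℝ :=
    a.bilinearComp π₁ π₁ + b.flip.bilinearComp π₂ π₁ - b.bilinearComp π₁ π₂ +
      c.bilinearComp π₂ π₂
  have hB_apply : ∀ x y, B x y =
      a x.fst y.fst + b y.fst x.snd - b x.fst y.snd + c x.snd y.snd := fun _ _ ↦ rfl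
  have hB : IsCoercive B := by
    refine ⟨min α γ, lt_min hα hγ, fun x ↦ ?_⟩
    rw [hB_apply, mul_assoc, ← pow_two, WithLp.prod_norm_sq_eq_of_L2]
    have h₁ := mul_le_mul_of_nonneg_right (min_le_left α γ) (sq_nonneg ‖x.fst‖)
    have h₂ := mul_le_mul_of_nonneg_right (min_le_right α γ) (sq_nonneg ‖x.snd‖)
    linarith [ha x.fst, hc x.snd]
  obtain ⟨w, hw, h⟩ := hB.exists_variational_inequality (K := π₁ ⁻¹' K)
    (hne.imp' (fun v ↦ WithLp.toLp 2 (v, 0)) fun _ hv ↦ hv) (hcl.preimage π₁.continuous)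
    (hcx.linear_preimage π₁.toLinearMap) (F.comp π₁)
  have key : ∀ v ∈ K, ∀ q : Q, F (v - w.fst) ≤
      a w.fst (v - w.fst) + b (v - w.fst) w.snd - b w.fst q + c w.snd q := fun v hv q ↦ by
    have := h (WithLp.toLp 2 (v, w.snd + q)) hv
    rw [hB_apply] at this
    simpa [π₁] using this
  refine ⟨w.fst, hw, w.snd, fun v hv ↦ by simpa using key v hv 0, fun q ↦ ?_⟩
  have h₁ := key w.fst hw q
  have h₂ := key w.fst hw (-q)
  simp only [sub_self, map_zero, map_neg, zero_apply] at h₁ h₂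
  linarith

/-- Let `V` and `Q` be real Hilbert spaces, `a` a continuous symmetric coercive bilinear
form on `V` (with coercivity constant `α > 0`), `b` a continuous bilinear form on `V × Q`,
`c` a continuous symmetric coercive bilinear form on `Q` (with coercivity constant `γ > 0`),
`K ⊆ V` a nonempty closed convex set and `F` a continuous linear functional on `V`.
Then there is exactly one pair `(u, p) ∈ K × Q` solving the mixed variational inequality
system: `a(u, v − u) + b(v − u, p) ≥ F(v − u)` for all `v ∈ K`, and
`b(u, q) − c(p, q) = 0` for all `q ∈ Q`. -/
theorem stmt_4 {V Q : Type*}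
    [NormedAddCommGroup V] [InnerProductSpace ℝ V] [CompleteSpace V]
    [NormedAddCommGroup Q] [InnerProductSpace ℝ Q] [CompleteSpace Q]
    (a : V →ₗ[ℝ] V →ₗ[ℝ] ℝ) (Ca : ℝ) (ha_cont : ∀ u v : V, |a u v| ≤ Ca * ‖u‖ * ‖v‖)
    (ha_symm : ∀ u v : V, a u v = a v u)
    (α : ℝ) (hα : 0 < α) (ha_coer : ∀ v : V, a v v ≥ α * ‖v‖ ^ 2)
    (b : V →ₗ[ℝ] Q →ₗ[ℝ] ℝ) (Cb : ℝ) (hb_cont : ∀ (v : V) (q : Q), |b v q| ≤ Cb * ‖v‖ * ‖q‖)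
    (c : Q →ₗ[ℝ] Q →ₗ[ℝ] ℝ) (Cc : ℝ) (hc_cont : ∀ p q : Q, |c p q| ≤ Cc * ‖p‖ * ‖q‖)
    (hc_symm : ∀ p q : Q, c p q = c q p)
    (γ : ℝ) (hγ : 0 < γ) (hc_coer : ∀ q : Q, c q q ≥ γ * ‖q‖ ^ 2)
    (K : Set V) (hK_ne : K.Nonempty) (hK_cl : IsClosed K) (hK_cx : Convex ℝ K)
    (F : V →L[ℝ] ℝ) :
    ∃! up : V × Q, up.1 ∈ K ∧
      (∀ v ∈ K, a up.1 (v - up.1) + b (v - up.1) up.2 ≥ F (v - up.1)) ∧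
      (∀ q : Q, b up.1 q - c up.2 q = 0) := by
  refine existsUnique_of_exists_of_unique ?_ ?_
  · have ha : IsCoercive (a.mkContinuous₂ Ca ha_cont) :=
      ⟨α, hα, fun v ↦ by simpa [pow_two, mul_assoc] using ha_coer v⟩
    have hc : IsCoercive (c.mkContinuous₂ Cc hc_cont) :=
      ⟨γ, hγ, fun q ↦ by simpa [pow_two, mul_assoc] using hc_coer q⟩
    obtain ⟨u, hu, p, h₁, h₂⟩ := exists_mixed_variational_inequality ha
      (b.mkContinuous₂ Cb hb_cont) hc hK_ne hK_cl hK_cx F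
    exact ⟨(u, p), hu, h₁, h₂⟩
  · rintro ⟨u, p⟩ ⟨u', p'⟩ ⟨hu, h, hq⟩ ⟨hu', h', hq'⟩
    have h₁ := h u' hu'
    have h₂ := h' u hu
    have ha := ha_coer (u - u')
    have hc := hc_coer (p - p')
    have e₁ := hq p
    have e₂ := hq p'
    have e₃ := hq' p
    have e₄ := hq' p'
    simp only [map_sub, LinearMap.sub_apply] at h₁ h₂ ha hc e₁ e₂ e₃ e₄
    have hsum : α * ‖u - u'‖ ^ 2 + γ * ‖p - p'‖ ^ 2 ≤ 0 := by linarith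
    have hnu : 0 ≤ α * ‖u - u'‖ ^ 2 := by positivity
    have hnp : 0 ≤ γ * ‖p - p'‖ ^ 2 := by positivity
    have hu0 : α * ‖u - u'‖ ^ 2 = 0 := by linarith
    have hp0 : γ * ‖p - p'‖ ^ 2 = 0 := by linarith
    simp only [mul_eq_zero, hα.ne', hγ.ne', false_or, pow_eq_zero_iff two_ne_zero,
      norm_eq_zero, sub_eq_zero] at hu0 hp0
    rw [hu0, hp0]
end

section
/- Let V and Q be real inner product spaces, let a : V × V → ℝ be a bilinear form that is coercive with constant α > 0, let b : V × Q → ℝ be bilinear, let c : Q × Q → ℝ be a bilinear form with c(q, q) ≥ 0 for all q ∈ Q, let K ⊆ V be a nonempty convex set, and let F : V → ℝ be linear. If (u₁, p₁) ∈ K × Q and (u₂, p₂) ∈ K × Q both solve the mixed variational inequality system for the data (a, b, c, K, F), then u₁ = u₂ and c(p₁ − p₂, p₁ − p₂) = 0. -/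
/-- Let `V` and `Q` be real inner product spaces, `a` a bilinear form on `V` coercive with
constant `α > 0`, `b` bilinear on `V × Q`, `c` a positive-semidefinite bilinear form on `Q`,
`K ⊆ V` nonempty convex, and `F : V → ℝ` linear. If `(u₁, p₁)` and `(u₂, p₂)` (with
`u₁, u₂ ∈ K`) both solve the mixed variational inequality system for `(a, b, c, K, F)`,
then `u₁ = u₂` and `c(p₁ − p₂, p₁ − p₂) = 0`. -/
theorem stmt_5 {V Q : Type*}
    [NormedAddCommGroup V] [InnerProductSpace ℝ V]
    [NormedAddCommGroup Q] [InnerProductSpace ℝ Q]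
    (a : V →ₗ[ℝ] V →ₗ[ℝ] ℝ)
    (α : ℝ) (hα : 0 < α) (ha_coer : ∀ v : V, a v v ≥ α * ‖v‖ ^ 2)
    (b : V →ₗ[ℝ] Q →ₗ[ℝ] ℝ)
    (c : Q →ₗ[ℝ] Q →ₗ[ℝ] ℝ) (hc_pos : ∀ q : Q, 0 ≤ c q q)
    (K : Set V) (hK_ne : K.Nonempty) (hK_cx : Convex ℝ K)
    (F : V →ₗ[ℝ] ℝ)
    (u₁ u₂ : V) (p₁ p₂ : Q) (h₁K : u₁ ∈ K) (h₂K : u₂ ∈ K)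
    (h₁a : ∀ v ∈ K, a u₁ (v - u₁) + b (v - u₁) p₁ ≥ F (v - u₁))
    (h₁b : ∀ q : Q, b u₁ q - c p₁ q = 0)
    (h₂a : ∀ v ∈ K, a u₂ (v - u₂) + b (v - u₂) p₂ ≥ F (v - u₂))
    (h₂b : ∀ q : Q, b u₂ q - c p₂ q = 0) :
    u₁ = u₂ ∧ c (p₁ - p₂) (p₁ - p₂) = 0 := by
  have hsum : a (u₁ - u₂) (u₁ - u₂) + c (p₁ - p₂) (p₁ - p₂) ≤ 0 := by
    have h₁ := h₁a u₂ h₂K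
    have h₂ := h₂a u₁ h₁K
    have e₁ := h₁b (p₁ - p₂)
    have e₂ := h₂b (p₁ - p₂)
    simp only [map_sub, LinearMap.sub_apply] at h₁ h₂ e₁ e₂ ⊢
    linarith
  have hc := hc_pos (p₁ - p₂)
  have ha := ha_coer (u₁ - u₂)
  have hnorm : 0 ≤ α * ‖u₁ - u₂‖ ^ 2 := by positivity
  have hzero : α * ‖u₁ - u₂‖ ^ 2 = 0 := by linarith
  refine ⟨?_, by linarith⟩
  simpa [hα.ne', sub_eq_zero] using hzero
end

section
/- Let V be a real Hilbert space and Q a real normed space, let a : V × V → ℝ be a bilinear form that is coercive with constant α > 0 and satisfies |a(u, v)| ≤ C_a ‖u‖ ‖v‖ for all u, v, let b : V × Q → ℝ be bilinear, let c : Q × Q → ℝ be a bilinear form with c(q, q) ≥ 0 for all q ∈ Q, and let F : V → ℝ be a continuous linear functional with operator norm ‖F‖. Let K ⊆ V be a closed convex set with 0 ∈ K, let W ⊆ V be a subspace such that u' + w ∈ K for every u' ∈ K and w ∈ W, let H ⊆ Q be a closed subspace, and assume the inf-sup condition: there is β > 0 such that for every q ∈ Q, sup_{w ∈ W, w ≠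 0} b(w, q)/‖w‖ ≥ β ‖q‖_{Q/H}. If (u, p) ∈ K × Q solves the mixed variational inequality system for the data (a, b, c, K, F), then ‖u‖ ≤ ‖F‖/α and ‖p‖_{Q/H} ≤ β^{-1} (1 + C_a/α) ‖F‖. In particular, these bounds are independent of the form c. -/
/-- The quotient norm `‖q‖_{Q/H} = inf_{h ∈ H} ‖q + h‖` of `q` modulo a subspace `H`. -/
noncomputable def quotNorm {Q : Type*} [NormedAddCommGroup Q] [NormedSpace ℝ Q]
    (H : Submodule ℝ Q) (q : Q) : ℝ :=
  ⨅ h : H, ‖q + (h : Q)‖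

/-- Stability estimate for the mixed variational inequality system: with `a` coercive
(constant `α`) and bounded (constant `C_a`), `c` positive semidefinite, `K` closed convex
containing `0`, `W` a subspace with `K + W ⊆ K`, `H ⊆ Q` a closed subspace, and the
inf-sup condition with constant `β > 0` (the supremum being taken over nonzero `w ∈ W`),
any solution `(u, p)` satisfies `‖u‖ ≤ ‖F‖/α` and
`‖p‖_{Q/H} ≤ β⁻¹ (1 + C_a/α) ‖F‖`; in particular the bounds do not involve `c`. -/
theorem stmt_6 {V Q : Type*}
    [NormedAddCommGroup V] [InnerProductSpace ℝ V] [CompleteSpace V]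
    [NormedAddCommGroup Q] [NormedSpace ℝ Q]
    (a : V →ₗ[ℝ] V →ₗ[ℝ] ℝ)
    (α : ℝ) (hα : 0 < α) (ha_coer : ∀ v : V, a v v ≥ α * ‖v‖ ^ 2)
    (Ca : ℝ) (ha_cont : ∀ u v : V, |a u v| ≤ Ca * ‖u‖ * ‖v‖)
    (b : V →ₗ[ℝ] Q →ₗ[ℝ] ℝ)
    (c : Q →ₗ[ℝ] Q →ₗ[ℝ] ℝ) (hc_pos : ∀ q : Q, 0 ≤ c q q)
    (F : V →L[ℝ] ℝ)
    (K : Set V) (hK_cl : IsClosed K) (hK_cx : Convex ℝ K) (hK0 : (0 : V) ∈ K)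
    (W : Submodule ℝ V) (hKW : ∀ u' ∈ K, ∀ w ∈ W, u' + w ∈ K)
    (H : Submodule ℝ Q) (hH_cl : IsClosed (H : Set Q))
    (β : ℝ) (hβ : 0 < β)
    (hinfsup : ∀ q : Q,
      β * quotNorm H q ≤ ⨆ w : {w : V // w ∈ W ∧ w ≠ 0}, b (w : V) q / ‖(w : V)‖)
    (u : V) (p : Q) (huK : u ∈ K)
    (hsol1 : ∀ v ∈ K, a u (v - u) + b (v - u) p ≥ F (v - u))
    (hsol2 : ∀ q : Q, b u q - c p q = 0) :
    ‖u‖ ≤ ‖F‖ / α ∧ quotNorm H p ≤ β⁻¹ * (1 + Ca / α) * ‖F‖ := by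
  have hFle : ∀ w : V, F w ≤ ‖F‖ * ‖w‖ := fun w => (le_abs_self _).trans (F.le_opNorm w)
  have hu : ‖u‖ ≤ ‖F‖ / α := by
    have h0 := hsol1 0 hK0
    simp only [zero_sub, map_neg, LinearMap.neg_apply] at h0
    have hb : 0 ≤ b u p := by linarith [hsol2 p, hc_pos p]
    rw [le_div_iff₀ hα]
    rcases (norm_nonneg u).eq_or_lt with hz | hpos
    · simp [← hz]
    · refine le_of_mul_le_mul_right ?_ hpos
      linarith [ha_coer u, hFle u]
  refine ⟨hu, ?_⟩
  have hCa_nonneg : ∀ w : V, w ≠ 0 → 0 ≤ Ca := fun w hw => by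
    have hpos : 0 < ‖w‖ := norm_pos_iff.2 hw
    by_contra! hneg
    have h1 := (abs_nonneg _).trans (ha_cont w w)
    have h2 : Ca * ‖w‖ * ‖w‖ < 0 := mul_neg_of_neg_of_pos (mul_neg_of_neg_of_pos hneg hpos) hpos
    linarith
  have hbound : (⨆ w : {w : V // w ∈ W ∧ w ≠ 0}, b (w : V) p / ‖(w : V)‖)
      ≤ (1 + Ca / α) * ‖F‖ := by
    refine Real.iSup_le ?_ ?_
    · rintro ⟨w, hwW, hw⟩
      have hpos : 0 < ‖w‖ := norm_pos_iff.2 hw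
      have h := hsol1 (u + -w) (hKW u huK (-w) (W.neg_mem hwW))
      simp only [add_sub_cancel_left, map_neg, LinearMap.neg_apply] at h
      have hCu : Ca * ‖u‖ ≤ Ca * (‖F‖ / α) :=
        mul_le_mul_of_nonneg_left hu (hCa_nonneg w hw)
      rw [div_le_iff₀ hpos]
      calc b w p ≤ F w - a u w := by linarith
        _ ≤ ‖F‖ * ‖w‖ + Ca * ‖u‖ * ‖w‖ := by
          linarith [hFle w, neg_abs_le (a u w), ha_cont u w]
        _ ≤ ‖F‖ * ‖w‖ + Ca * (‖F‖ / α) * ‖w‖ := by gcongr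
        _ = (1 + Ca / α) * ‖F‖ * ‖w‖ := by ring
    · rcases subsingleton_or_nontrivial V with _ | _
      · simp [Subsingleton.elim F 0]
      · obtain ⟨w, hw⟩ := exists_ne (0 : V)
        have := hCa_nonneg w hw
        positivity
  rw [mul_assoc, inv_mul_eq_div, le_div_iff₀ hβ, mul_comm]
  exact (hinfsup p).trans hbound
end

section
/- Let V be a real normed space, Q a real normed space, H ⊆ Q a closed subspace, W ⊆ V a subspace, W_h ⊆ W a subspace, Q_h ⊆ Q a subset, and b : V × Q → ℝ a bilinear map. Assume the inf-sup condition: there is β > 0 such that for every q_h ∈ Q_h, sup_{w ∈ W, w ≠ 0} b(w, q_h)/‖w‖ ≥ β ‖q_h‖_{Q/H}. Suppose there exist a constant C_Π > 0 and a map Π : W → W_h (not assumed linear) such that b(Π w − w, q_h) = 0 for all w ∈ W and q_h ∈ Q_h, and ‖Π w‖ ≤ C_Π ‖w‖ for all w ∈ W. Then for every q_h ∈ Q_h, sup_{w_h ∈ W_h, w_h ≠ 0} b(w_h, q_h)/‖w_h‖ ≥ (β / C_Π) ‖q_h‖_{Q/H}. -/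
/-- The real supremum of the quotients `f w / ‖w‖` over a subspace is nonnegative. -/
lemma iSup_div_norm_nonneg {V : Type*} [NormedAddCommGroup V] [NormedSpace ℝ V]
    (W : Submodule ℝ V) (f : V →ₗ[ℝ] ℝ) :
    0 ≤ ⨆ w : {w : V // w ∈ W ∧ w ≠ 0}, f (w : V) / ‖(w : V)‖ := by
  rcases isEmpty_or_nonempty {w : V // w ∈ W ∧ w ≠ 0} with _ | ⟨⟨w, hw, hw0⟩⟩
  · rw [Real.iSup_of_isEmpty]
  · apply Real.iSup_nonneg'
    rcases le_total 0 (f w) with h | h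
    · exact ⟨⟨w, hw, hw0⟩, div_nonneg h (norm_nonneg _)⟩
    · refine ⟨⟨-w, W.neg_mem hw, neg_ne_zero.mpr hw0⟩, div_nonneg ?_ (norm_nonneg _)⟩
      simpa using h

/-- Restricting to a subspace through a bounded map that preserves the values of `f` costs at
most the bound of the map in the supremum of `f w / ‖w‖`. -/
lemma iSup_div_norm_le_mul_iSup {V : Type*} [NormedAddCommGroup V] [NormedSpace ℝ V]
    {W Wh : Submodule ℝ V} (hle : Wh ≤ W) (f : V →ₗ[ℝ] ℝ) {C : ℝ} (hC : 0 ≤ C) (P : V → V)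
    (hPmem : ∀ w ∈ W, P w ∈ Wh) (hPf : ∀ w ∈ W, f (P w) = f w)
    (hPbd : ∀ w ∈ W, ‖P w‖ ≤ C * ‖w‖) :
    ⨆ w : {w : V // w ∈ W ∧ w ≠ 0}, f (w : V) / ‖(w : V)‖ ≤
      C * ⨆ w : {w : V // w ∈ Wh ∧ w ≠ 0}, f (w : V) / ‖(w : V)‖ := by
  have hnonneg := iSup_div_norm_nonneg Wh f
  by_cases hbdd : BddAbove
      (Set.range fun w : {w : V // w ∈ Wh ∧ w ≠ 0} => f (w : V) / ‖(w : V)‖)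
  · refine Real.iSup_le ?_ (mul_nonneg hC hnonneg)
    rintro ⟨w, hw, hw0⟩
    have hbound : f (P w) ≤
        (⨆ w : {w : V // w ∈ Wh ∧ w ≠ 0}, f (w : V) / ‖(w : V)‖) * ‖P w‖ := by
      by_cases h0 : P w = 0
      · simp [h0]
      · rw [← div_le_iff₀ (norm_pos_iff.mpr h0)]
        exact le_ciSup hbdd ⟨P w, hPmem w hw, h0⟩
    rw [div_le_iff₀ (norm_pos_iff.mpr hw0), ← hPf w hw]
    calc f (P w) ≤ _ := hbound
      _ ≤ _ := mul_le_mul_of_nonneg_left (hPbd w hw) hnonneg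
      _ = _ := by ring
  · have hW : ¬ BddAbove
        (Set.range fun w : {w : V // w ∈ W ∧ w ≠ 0} => f (w : V) / ‖(w : V)‖) := by
      refine fun h => hbdd (h.mono ?_)
      rintro _ ⟨⟨w, hw, hw0⟩, rfl⟩
      exact ⟨⟨w, hle hw, hw0⟩, rfl⟩
    rw [Real.iSup_of_not_bddAbove hW]
    exact mul_nonneg hC hnonneg

/-- Fortin's trick: if the inf-sup condition with constant `β > 0` holds on `W` for all
`q_h ∈ Q_h`, and there is a (not necessarily linear) operator `P : W → W_h` with
`b(P w − w, q_h) = 0` and `‖P w‖ ≤ C_P ‖w‖`, then the discrete inf-sup condition holds on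
`W_h` with constant `β / C_P`.  (The real-valued supremum over an empty index set is `0`,
so when no nonzero `w_h` exists the conclusion forces `‖q_h‖_{Q/H} = 0`.) -/
theorem stmt_7 {V Q : Type*}
    [NormedAddCommGroup V] [NormedSpace ℝ V]
    [NormedAddCommGroup Q] [NormedSpace ℝ Q]
    (H : Submodule ℝ Q) (hH_cl : IsClosed (H : Set Q))
    (W Wh : Submodule ℝ V) (hWhW : Wh ≤ W)
    (Qh : Set Q)
    (b : V →ₗ[ℝ] Q →ₗ[ℝ] ℝ)
    (β : ℝ) (hβ : 0 < β)
    (hinfsup : ∀ qh ∈ Qh,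
      β * quotNorm H qh ≤ ⨆ w : {w : V // w ∈ W ∧ w ≠ 0}, b (w : V) qh / ‖(w : V)‖)
    (CP : ℝ) (hCP : 0 < CP) (P : V → V)
    (hPmem : ∀ w ∈ W, P w ∈ Wh)
    (hPb : ∀ w ∈ W, ∀ qh ∈ Qh, b (P w - w) qh = 0)
    (hPbd : ∀ w ∈ W, ‖P w‖ ≤ CP * ‖w‖) :
    ∀ qh ∈ Qh,
      (β / CP) * quotNorm H qh ≤
        ⨆ w : {w : V // w ∈ Wh ∧ w ≠ 0}, b (w : V) qh / ‖(w : V)‖ := by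
  intro qh hqh
  have hPf : ∀ w ∈ W, b.flip qh (P w) = b.flip qh w := fun w hw => by
    simpa [sub_eq_zero] using hPb w hw qh hqh
  have h := (hinfsup qh hqh).trans
    (iSup_div_norm_le_mul_iSup hWhW (b.flip qh) hCP.le P hPmem hPf hPbd)
  rw [div_mul_eq_mul_div, div_le_iff₀' hCP]
  exact h
end

section
/- Let V and Q be real normed spaces, H ⊆ Q a closed subspace, W_h ⊆ V a subspace, and Q_h ⊆ Q a subspace. Let b : V × Q → ℝ be a bilinear map satisfying |b(w, q)| ≤ ‖w‖ · ‖q‖_{Q/H} for all w ∈ W_h and q ∈ Q. Assume the discrete inf-sup condition: there is β_h > 0 such that for every q_h ∈ Q_h, sup_{w_h ∈ W_h, w_h ≠ 0} b(w_h, q_h)/‖w_h‖ ≥ β_h ‖q_h‖_{Q/H}. Let p ∈ Q, p_h ∈ Q_h and δ ≥ 0 be such that |b(w_h, p − p_h)| ≤ δ ‖w_h‖ for all w_h ∈ W_h. Then for every p_I ∈ Q_h one has ‖p − p_h‖_{Q/H} ≤ (1 + 1/β_h) ‖p − p_I‖_{Q/H} + δ/β_h. -/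
theorem quotNorm_nonneg {Q : Type*} [NormedAddCommGroup Q] [NormedSpace ℝ Q]
    (H : Submodule ℝ Q) (q : Q) : 0 ≤ quotNorm H q :=
  Real.iInf_nonneg fun _ => norm_nonneg _

theorem quotNorm_add_le {Q : Type*} [NormedAddCommGroup Q] [NormedSpace ℝ Q]
    (H : Submodule ℝ Q) (q r : Q) : quotNorm H (q + r) ≤ quotNorm H q + quotNorm H r := by
  refine le_ciInf_add_ciInf fun g h => ?_
  have hbdd : BddBelow (Set.range fun k : H => ‖q + r + (k : Q)‖) :=
    ⟨0, by rintro _ ⟨k, rfl⟩; exact norm_nonneg _⟩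
  calc quotNorm H (q + r) ≤ ‖q + r + ((g + h : H) : Q)‖ := ciInf_le hbdd (g + h)
    _ = ‖(q + g) + (r + h)‖ := by rw [Submodule.coe_add, add_add_add_comm]
    _ ≤ ‖q + (g : Q)‖ + ‖r + (h : Q)‖ := norm_add_le _ _

/-- Abstract pressure error estimate: with `b` bilinear and bounded by the quotient norm
(`|b(w, q)| ≤ ‖w‖ ‖q‖_{Q/H}` for `w ∈ W_h`), the discrete inf-sup condition with constant
`β_h > 0`, and a consistency bound `|b(w_h, p − p_h)| ≤ δ ‖w_h‖` on `W_h`, one has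
`‖p − p_h‖_{Q/H} ≤ (1 + 1/β_h) ‖p − p_I‖_{Q/H} + δ/β_h` for every `p_I ∈ Q_h`. -/
theorem stmt_8 {V Q : Type*}
    [NormedAddCommGroup V] [NormedSpace ℝ V]
    [NormedAddCommGroup Q] [NormedSpace ℝ Q]
    (H : Submodule ℝ Q) (hH_cl : IsClosed (H : Set Q))
    (Wh : Submodule ℝ V) (Qh : Submodule ℝ Q)
    (b : V →ₗ[ℝ] Q →ₗ[ℝ] ℝ)
    (hb_cont : ∀ w ∈ Wh, ∀ q : Q, |b w q| ≤ ‖w‖ * quotNorm H q)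
    (βh : ℝ) (hβh : 0 < βh)
    (hinfsup : ∀ qh ∈ Qh,
      βh * quotNorm H qh ≤ ⨆ w : {w : V // w ∈ Wh ∧ w ≠ 0}, b (w : V) qh / ‖(w : V)‖)
    (p : Q) (ph : Q) (hph : ph ∈ Qh)
    (δ : ℝ) (hδ : 0 ≤ δ)
    (hconsist : ∀ wh ∈ Wh, |b wh (p - ph)| ≤ δ * ‖wh‖) :
    ∀ pI ∈ Qh, quotNorm H (p - ph) ≤ (1 + 1 / βh) * quotNorm H (p - pI) + δ / βh := by
  intro pI hpI
  have hsup : βh * quotNorm H (pI - ph) ≤ δ + quotNorm H (p - pI) := by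
    refine (hinfsup _ (Qh.sub_mem hpI hph)).trans
      (Real.iSup_le ?_ (add_nonneg hδ (quotNorm_nonneg H _)))
    rintro ⟨w, hw, hw0⟩
    rw [div_le_iff₀ (norm_pos_iff.mpr hw0)]
    have hsplit : b w (pI - ph) = b w (p - ph) - b w (p - pI) := by
      rw [← map_sub, sub_sub_sub_cancel_left]
    have h₁ := le_of_abs_le (hconsist w hw)
    have h₂ := neg_le_of_abs_le (hb_cont w hw (p - pI))
    linarith
  have htri : quotNorm H (p - ph) ≤ quotNorm H (p - pI) + quotNorm H (pI - ph) := by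
    simpa using quotNorm_add_le H (p - pI) (pI - ph)
  calc quotNorm H (p - ph) ≤ quotNorm H (p - pI) + quotNorm H (pI - ph) := htri
    _ ≤ quotNorm H (p - pI) + (δ + quotNorm H (p - pI)) / βh := by
      gcongr
      rwa [le_div_iff₀' hβh]
    _ = (1 + 1 / βh) * quotNorm H (p - pI) + δ / βh := by ring
end

section
/- Let V and Q be real Hilbert spaces, let b : V × Q → ℝ be a continuous bilinear form, and let c : Q × Q → ℝ be a continuous symmetric bilinear form that is coercive with constant γ > 0. Then: (i) there exists a unique bounded linear operator S : V → Q such that c(S v, q) = b(v, q) for all v ∈ V and q ∈ Q, and it satisfies c(S u, S v) = b(u, S v) = b(v, S u) for all u, v ∈ V; (ii) for every bilinear form a : V × V → ℝ, every set K ⊆ V and every linear functional F : V → ℝ, a pair (u, p) ∈ K × Q solves the mixed variational inequality system for the data (a, b, c, K, F) if and only if p = S u and a(u, v − u) + c(S u, S(v − u)) ≥ F(v − u) for all v ∈ K. -/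
/-- A coercive bilinear form separates points. -/
theorem eq_of_coercive_form_eq {Q : Type*} [NormedAddCommGroup Q] [InnerProductSpace ℝ Q]
    {c : Q →ₗ[ℝ] Q →ₗ[ℝ] ℝ} {γ : ℝ} (hγ : 0 < γ) (hc : ∀ q : Q, c q q ≥ γ * ‖q‖ ^ 2)
    {p p' : Q} (h : ∀ q, c p q = c p' q) : p = p' := by
  have hzero : c (p - p') (p - p') = 0 := by
    rw [map_sub c, LinearMap.sub_apply, h, sub_self]
  have hle := hc (p - p')
  rw [hzero] at hle
  have hsq : ‖p - p'‖ ^ 2 = 0 := le_antisymm (by nlinarith) (sq_nonneg _)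
  exact sub_eq_zero.mp (norm_eq_zero.mp (pow_eq_zero_iff two_ne_zero |>.mp hsq))

/-- The Lax-Milgram theorem for a bounded coercive form given by a bilinear map. -/
theorem exists_coercive_form_eq {Q : Type*} [NormedAddCommGroup Q] [InnerProductSpace ℝ Q]
    [CompleteSpace Q] {c : Q →ₗ[ℝ] Q →ₗ[ℝ] ℝ} {C γ : ℝ}
    (hcont : ∀ p q : Q, |c p q| ≤ C * ‖p‖ * ‖q‖)
    (hγ : 0 < γ) (hc : ∀ q : Q, c q q ≥ γ * ‖q‖ ^ 2) (f : Q →L[ℝ] ℝ) :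
    ∃ p, ∀ q, c p q = f q := by
  let B : Q →L[ℝ] Q →L[ℝ] ℝ := c.mkContinuous₂ C hcont
  have hB : IsCoercive B :=
    ⟨γ, hγ, fun q => by simpa [B, pow_two, mul_assoc] using hc q⟩
  refine ⟨hB.continuousLinearEquivOfBilin.symm ((InnerProductSpace.toDual ℝ Q).symm f),
    fun q => ?_⟩
  calc
    _ = B _ q := rfl
    _ = f q := by
      rw [← hB.continuousLinearEquivOfBilin_apply, ContinuousLinearEquiv.apply_symm_apply,
        InnerProductSpace.toDual_symm_apply]

/-- A bounded bilinear form is represented through a bounded coercive form by a bounded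
linear operator. -/
theorem exists_continuousLinearMap_coercive_form_eq {V Q : Type*}
    [NormedAddCommGroup V] [InnerProductSpace ℝ V]
    [NormedAddCommGroup Q] [InnerProductSpace ℝ Q] [CompleteSpace Q]
    {b : V →ₗ[ℝ] Q →ₗ[ℝ] ℝ} {Cb : ℝ} (hb : ∀ (v : V) (q : Q), |b v q| ≤ Cb * ‖v‖ * ‖q‖)
    {c : Q →ₗ[ℝ] Q →ₗ[ℝ] ℝ} {Cc γ : ℝ} (hcont : ∀ p q : Q, |c p q| ≤ Cc * ‖p‖ * ‖q‖)
    (hγ : 0 < γ) (hc : ∀ q : Q, c q q ≥ γ * ‖q‖ ^ 2) :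
    ∃ S : V →L[ℝ] Q, ∀ (v : V) (q : Q), c (S v) q = b v q := by
  let B : V →L[ℝ] Q →L[ℝ] ℝ := b.mkContinuous₂ Cb hb
  choose s hs using fun v => exists_coercive_form_eq hcont hγ hc (B v)
  let T : V →ₗ[ℝ] Q :=
    { toFun := s
      map_add' := fun x y => eq_of_coercive_form_eq hγ hc fun q => by simp [hs]
      map_smul' := fun r x => eq_of_coercive_form_eq hγ hc fun q => by simp [hs] }
  refine ⟨T.mkContinuous (‖B‖ / γ) fun v => ?_, hs⟩
  change ‖s v‖ ≤ _
  rw [div_mul_eq_mul_div, le_div_iff₀ hγ]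
  rcases (norm_nonneg (s v)).eq_or_lt with h | h
  · rw [← h, zero_mul]
    positivity
  · refine le_of_mul_le_mul_right ?_ h
    calc
      ‖s v‖ * γ * ‖s v‖ = γ * ‖s v‖ ^ 2 := by ring
      _ ≤ B v (s v) := (hc (s v)).trans_eq (hs v (s v))
      _ ≤ ‖B v (s v)‖ := Real.le_norm_self _
      _ ≤ ‖B‖ * ‖v‖ * ‖s v‖ := B.le_opNorm₂ v (s v)

/-- Let `V`, `Q` be real Hilbert spaces, `b` a continuous bilinear form on `V × Q`, and `c`
a continuous symmetric bilinear form on `Q`, coercive with constant `γ > 0`.  Then: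
(i) there is a unique bounded linear operator `S : V → Q` with `c(S v, q) = b(v, q)` for all
`v, q`, and any such `S` satisfies `c(S u, S v) = b(u, S v) = b(v, S u)`;
(ii) for any bilinear form `a` on `V`, any set `K ⊆ V` and any linear functional `F`, a pair
`(u, p)` with `u ∈ K` solves the mixed variational inequality system for `(a, b, c, K, F)`
iff `p = S u` and `a(u, v − u) + c(S u, S(v − u)) ≥ F(v − u)` for all `v ∈ K`. -/
theorem stmt_10 {V Q : Type*}
    [NormedAddCommGroup V] [InnerProductSpace ℝ V] [CompleteSpace V]
    [NormedAddCommGroup Q] [InnerProductSpace ℝ Q] [CompleteSpace Q]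
    (b : V →ₗ[ℝ] Q →ₗ[ℝ] ℝ) (Cb : ℝ) (hb_cont : ∀ (v : V) (q : Q), |b v q| ≤ Cb * ‖v‖ * ‖q‖)
    (c : Q →ₗ[ℝ] Q →ₗ[ℝ] ℝ) (Cc : ℝ) (hc_cont : ∀ p q : Q, |c p q| ≤ Cc * ‖p‖ * ‖q‖)
    (hc_symm : ∀ p q : Q, c p q = c q p)
    (γ : ℝ) (hγ : 0 < γ) (hc_coer : ∀ q : Q, c q q ≥ γ * ‖q‖ ^ 2) :
    (∃! S : V →L[ℝ] Q, ∀ (v : V) (q : Q), c (S v) q = b v q) ∧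
    (∀ S : V →L[ℝ] Q, (∀ (v : V) (q : Q), c (S v) q = b v q) →
      ((∀ u v : V, c (S u) (S v) = b u (S v) ∧ b u (S v) = b v (S u)) ∧
       (∀ (a : V →ₗ[ℝ] V →ₗ[ℝ] ℝ) (K : Set V) (F : V →ₗ[ℝ] ℝ) (u : V) (p : Q), u ∈ K →
         (((∀ v ∈ K, a u (v - u) + b (v - u) p ≥ F (v - u)) ∧
            (∀ q : Q, b u q - c p q = 0)) ↔
          (p = S u ∧ ∀ v ∈ K, a u (v - u) + c (S u) (S (v - u)) ≥ F (v - u)))))) := by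
  obtain ⟨S, hS⟩ := exists_continuousLinearMap_coercive_form_eq hb_cont hc_cont hγ hc_coer
  refine ⟨⟨S, hS, fun T hT => ?_⟩, fun S hS => ⟨fun u v => ⟨hS u (S v), ?_⟩, ?_⟩⟩
  · ext v
    exact eq_of_coercive_form_eq hγ hc_coer fun q => (hT v q).trans (hS v q).symm
  · rw [← hS u, ← hS v, hc_symm]
  · intro a K F u p _
    have hsymm : ∀ w, c (S u) (S w) = b w (S u) := fun w => by rw [hc_symm, hS]
    simp only [hsymm]
    constructor
    · rintro ⟨hvi, heq⟩
      obtain rfl : p = S u := eq_of_coercive_form_eq hγ hc_coer fun q => by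
        rw [hS, ← sub_eq_zero.mp (heq q)]
      exact ⟨rfl, hvi⟩
    · rintro ⟨rfl, hvi⟩
      exact ⟨hvi, fun q => by rw [hS, sub_self]⟩
end
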